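/- arXiv:1910.00846 — 2 statements merged into one kernel-verified Lean document; each statement's English description precedes it below -/
import Mathlib

section
/- Let G be a finite simple graph on a nonempty vertex set of m vertices with adjacency matrix A and vertex degrees κ₁,…,κ_m. Then sqrt((1/m)·Σᵢ κᵢ²) ≤ λ_max(G), where λ_max(G) is the largest eigenvalue of A. -/
namespace Matrix.IsHermitian

variable {n : Type*} [Fintype n] [DecidableEq n] {A : Matrix n n ℝ} (hA : A.IsHermitian)

lemma sum_eigenvectorBasis_dotProduct_mul (x y : n → ℝ) :
    ∑ i, (⇑(hA.eigenvectorBasis i) ⬝ᵥ x) * (⇑(hA.eigenvectorBasis i) ⬝ᵥ y) = x ⬝ᵥ y := by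
  have h := hA.eigenvectorBasis.sum_inner_mul_inner (WithLp.toLp 2 x) (WithLp.toLp 2 y)
  simp only [EuclideanSpace.inner_eq_star_dotProduct, star_trivial] at h
  rw [dotProduct_comm x y, ← h]
  exact Finset.sum_congr rfl fun i _ ↦ by rw [dotProduct_comm y]

lemma eigenvectorBasis_dotProduct_mulVec (x : n → ℝ) (i : n) :
    ⇑(hA.eigenvectorBasis i) ⬝ᵥ (A *ᵥ x) =
      hA.eigenvalues i * (⇑(hA.eigenvectorBasis i) ⬝ᵥ x) := by
  have hT : Aᵀ = A := by simpa [IsHermitian, conjTranspose_eq_transpose_of_trivial] using hA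
  rw [dotProduct_mulVec, ← mulVec_transpose, hT, hA.mulVec_eigenvectorBasis, smul_dotProduct,
    smul_eq_mul]

lemma dotProduct_mulVec_le_iSup_eigenvalues (x : n → ℝ) :
    x ⬝ᵥ (A *ᵥ x) ≤ (⨆ i, hA.eigenvalues i) * (x ⬝ᵥ x) := by
  rw [← hA.sum_eigenvectorBasis_dotProduct_mul, ← hA.sum_eigenvectorBasis_dotProduct_mul x x,
    Finset.mul_sum]
  refine Finset.sum_le_sum fun i _ ↦ ?_
  rw [hA.eigenvectorBasis_dotProduct_mulVec, mul_left_comm]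
  exact mul_le_mul_of_nonneg_right (le_ciSup (Set.finite_range _).bddAbove i)
    (mul_self_nonneg _)

lemma abs_eigenvalues_le_iSup_eigenvalues (hpos : ∀ i j, 0 ≤ A i j) (i : n) :
    |hA.eigenvalues i| ≤ ⨆ j, hA.eigenvalues j := by
  set u : n → ℝ := ⇑(hA.eigenvectorBasis i) with hu
  have hu1 : u ⬝ᵥ u = 1 := by
    have h := real_inner_self_eq_norm_sq (hA.eigenvectorBasis i)
    rwa [EuclideanSpace.inner_eq_star_dotProduct, star_trivial, OrthonormalBasis.norm_eq_one,
      one_pow] at h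
  have habs : |u| ⬝ᵥ |u| = 1 := by
    simpa [dotProduct] using hu1
  calc |hA.eigenvalues i| = |u ⬝ᵥ (A *ᵥ u)| := by
        rw [hu, hA.eigenvectorBasis_dotProduct_mulVec, ← hu, hu1, mul_one]
    _ ≤ |u| ⬝ᵥ (A *ᵥ |u|) := by
        simp only [dotProduct, mulVec, Finset.mul_sum, Pi.abs_apply]
        refine (Finset.abs_sum_le_sum_abs _ _).trans (Finset.sum_le_sum fun j _ ↦ ?_)
        refine (Finset.abs_sum_le_sum_abs _ _).trans (Finset.sum_le_sum fun k _ ↦ ?_)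
        rw [abs_mul, abs_mul, abs_of_nonneg (hpos j k)]
    _ ≤ ⨆ j, hA.eigenvalues j := by
        simpa [habs] using hA.dotProduct_mulVec_le_iSup_eigenvalues |u|

lemma mulVec_dotProduct_mulVec_le (hpos : ∀ i j, 0 ≤ A i j) (x : n → ℝ) :
    (A *ᵥ x) ⬝ᵥ (A *ᵥ x) ≤ (⨆ i, hA.eigenvalues i) ^ 2 * (x ⬝ᵥ x) := by
  rw [← hA.sum_eigenvectorBasis_dotProduct_mul, ← hA.sum_eigenvectorBasis_dotProduct_mul x x,
    Finset.mul_sum]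
  refine Finset.sum_le_sum fun i _ ↦ ?_
  rw [hA.eigenvectorBasis_dotProduct_mulVec, mul_mul_mul_comm, ← sq (hA.eigenvalues i)]
  refine mul_le_mul_of_nonneg_right (sq_le_sq.2 ?_) (mul_self_nonneg _)
  exact (hA.abs_eigenvalues_le_iSup_eigenvalues hpos i).trans (le_abs_self _)

end Matrix.IsHermitian


/-- Hofmeister's bound: for a finite simple graph on a nonempty set of `m` vertices with
degrees `κ₁, …, κ_m`, one has `sqrt ((1/m) ∑ κᵢ²) ≤ λ_max(G)`. -/
theorem sqrt_mean_sq_degree_le_largest_eigenvalue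
    {V : Type*} [Fintype V] [DecidableEq V] [Nonempty V]
    (G : SimpleGraph V) [DecidableRel G.Adj]
    (hA : (G.adjMatrix ℝ).IsHermitian) :
    Real.sqrt ((∑ v : V, (G.degree v : ℝ) ^ 2) / (Fintype.card V : ℝ)) ≤
      ⨆ i : V, hA.eigenvalues i := by
  have hpos : ∀ i j, 0 ≤ G.adjMatrix ℝ i j := fun i j ↦ by
    rw [SimpleGraph.adjMatrix_apply]
    split_ifs <;> norm_num
  obtain ⟨v⟩ := ‹Nonempty V›
  have hnonneg : 0 ≤ ⨆ i : V, hA.eigenvalues i :=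
    (abs_nonneg _).trans (hA.abs_eigenvalues_le_iSup_eigenvalues hpos v)
  have hcard : (0 : ℝ) < Fintype.card V := by
    exact_mod_cast Fintype.card_pos_iff.2 ⟨v⟩
  rw [Real.sqrt_le_left hnonneg, div_le_iff₀ hcard]
  have h := hA.mulVec_dotProduct_mulVec_le hpos (Function.const V 1)
  simpa [dotProduct, SimpleGraph.adjMatrix_mulVec_const_apply, ← sq] using h
end

section
/- Let Γ be a finite set of real symmetric m×m matrices such that the multisets of absolute values of eigenvalues of the members of Γ are pairwise distinct and such that the largest eigenvalue of every A ∈ Γ is greater than 1. Then there exist two even natural numbers k₁ and k₂ such that the map A ↦ (tr(A^{k₁}), tr(A^{k₂})) is injective on Γ. -/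
open Filter Topology

/-- If all elements of `t` are smaller than some element of `s`, then the power sums of `s`
eventually exceed those of `t`. -/
theorem Multiset.eventually_sum_map_pow_lt {s t : Multiset ℝ} {a b : ℝ}
    (hs : ∀ x ∈ s, 0 ≤ x) (ht : ∀ x ∈ t, 0 ≤ x) (ha : a ∈ s) (htb : ∀ x ∈ t, x ≤ b)
    (hb : 0 ≤ b) (hba : b < a) :
    ∀ᶠ k : ℕ in atTop, (t.map (· ^ k)).sum < (s.map (· ^ k)).sum := by
  have ha0 : 0 < a := hb.trans_lt hba
  have hlim : Tendsto (fun k : ℕ => (t.card : ℝ) * (b / a) ^ k) atTop (𝓝 0) := by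
    simpa using (tendsto_pow_atTop_nhds_zero_of_lt_one (div_nonneg hb ha0.le)
      ((div_lt_one ha0).2 hba)).const_mul (t.card : ℝ)
  filter_upwards [hlim.eventually_lt_const one_pos] with k hk
  have hupper : (t.map (· ^ k)).sum ≤ t.card * b ^ k := by
    have := Multiset.sum_le_card_nsmul (t.map (· ^ k)) (b ^ k) (by
      intro y hy
      obtain ⟨x, hx, rfl⟩ := Multiset.mem_map.1 hy
      exact pow_le_pow_left₀ (ht x hx) (htb x hx) k)
    simpa using this
  have hlower : a ^ k ≤ (s.map (· ^ k)).sum := by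
    refine Multiset.single_le_sum ?_ _ (Multiset.mem_map_of_mem _ ha)
    intro y hy
    obtain ⟨x, hx, rfl⟩ := Multiset.mem_map.1 hy
    exact pow_nonneg (hs x hx) k
  rw [div_pow, ← mul_div_assoc, div_lt_one (pow_pos ha0 k)] at hk
  linarith

/-- A finite multiset of nonnegative reals is determined by its cardinality together with
infinitely many of its power sums. -/
theorem Multiset.eq_of_frequently_sum_map_pow_eq {s t : Multiset ℝ}
    (hs : ∀ x ∈ s, 0 ≤ x) (ht : ∀ x ∈ t, 0 ≤ x) (hcard : s.card = t.card)
    (h : ∃ᶠ k : ℕ in atTop, (s.map (· ^ k)).sum = (t.map (· ^ k)).sum) : s = t := by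
  induction hn : s.card generalizing s t with
  | zero =>
    rw [Multiset.card_eq_zero.1 hn, Multiset.card_eq_zero.1 (hcard.symm.trans hn)]
  | succ n ih =>
    have hs0 : s.toFinset.Nonempty := by
      rw [Multiset.toFinset_nonempty]
      rintro rfl
      simp at hn
    have ht0 : t.toFinset.Nonempty := by
      rw [Multiset.toFinset_nonempty]
      rintro rfl
      simp [hcard] at hn
    obtain ⟨a, ha, hsa⟩ := s.toFinset.exists_max_image id hs0
    obtain ⟨b, hb, htb⟩ := t.toFinset.exists_max_image id ht0
    simp only [Multiset.mem_toFinset, id] at ha hsa hb htb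
    have hab : a = b := by
      rcases lt_trichotomy a b with hlt | heq | hlt
      · obtain ⟨k, hk, hk'⟩ := (h.and_eventually
          (Multiset.eventually_sum_map_pow_lt ht hs hb hsa (hs a ha) hlt)).exists
        exact absurd hk hk'.ne
      · exact heq
      · obtain ⟨k, hk, hk'⟩ := (h.and_eventually
          (Multiset.eventually_sum_map_pow_lt hs ht ha htb (ht b hb) hlt)).exists
        exact absurd hk hk'.ne'
    subst hab
    obtain ⟨s, rfl⟩ := Multiset.exists_cons_of_mem ha
    obtain ⟨t, rfl⟩ := Multiset.exists_cons_of_mem hb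
    simp only [Multiset.card_cons, add_left_inj] at hcard hn
    rw [ih (fun x hx => hs x (Multiset.mem_cons_of_mem hx))
      (fun x hx => ht x (Multiset.mem_cons_of_mem hx)) hcard (by simpa using h) hn]

theorem Matrix.IsHermitian.trace_pow_eq_sum_eigenvalues_pow {n 𝕜 : Type*} [RCLike 𝕜]
    [Fintype n] [DecidableEq n] {A : Matrix n n 𝕜} (hA : A.IsHermitian) (k : ℕ) :
    (A ^ k).trace = ∑ i, (hA.eigenvalues i : 𝕜) ^ k := by
  conv_lhs => rw [hA.spectral_theorem, ← map_pow, Unitary.conjStarAlgAut_apply,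
    Matrix.trace_mul_comm, ← mul_assoc]
  simp [Matrix.diagonal_pow, Matrix.trace_diagonal]


/-- Let `Γ` be a finite set of real symmetric `m × m` matrices with pairwise distinct
absolute spectra (multisets of absolute values of eigenvalues), each having largest
eigenvalue greater than 1. Then there are two even natural numbers `k₁`, `k₂` such that
`A ↦ (tr (A ^ k₁), tr (A ^ k₂))` is injective on `Γ`. -/
theorem exists_two_even_newton_polynomials_injective
    {m : ℕ} (Γ : Finset (Matrix (Fin m) (Fin m) ℝ))
    (hsymm : ∀ A ∈ Γ, A.IsHermitian)
    (hdist : ∀ (A : Matrix (Fin m) (Fin m) ℝ) (hA : A ∈ Γ)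
        (B : Matrix (Fin m) (Fin m) ℝ) (hB : B ∈ Γ),
      Finset.univ.val.map (fun i => |(hsymm A hA).eigenvalues i|) =
          Finset.univ.val.map (fun i => |(hsymm B hB).eigenvalues i|) → A = B)
    (hmax : ∀ (A : Matrix (Fin m) (Fin m) ℝ) (hA : A ∈ Γ),
      1 < ⨆ i : Fin m, (hsymm A hA).eigenvalues i) :
    ∃ k₁ k₂ : ℕ, Even k₁ ∧ Even k₂ ∧
      Set.InjOn (fun A : Matrix (Fin m) (Fin m) ℝ =>
        (Matrix.trace (A ^ k₁), Matrix.trace (A ^ k₂))) ↑Γ := by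
  have key : ∀ A ∈ Γ, ∀ B ∈ Γ, ∀ᶠ k : ℕ in atTop,
      Matrix.trace (A ^ (2 * k)) = Matrix.trace (B ^ (2 * k)) → A = B := by
    intro A hA B hB
    by_contra hcon
    rw [not_eventually] at hcon
    obtain ⟨_, hk⟩ := hcon.exists
    refine hk fun _ => hdist A hA B hB (Multiset.eq_of_frequently_sum_map_pow_eq
      (by simp) (by simp) (by simp) ?_)
    refine (tendsto_id.const_mul_atTop' two_pos).frequently (hcon.mono fun k hk => ?_)
    have heq := (Classical.not_imp.1 hk).1
    rw [(hsymm A hA).trace_pow_eq_sum_eigenvalues_pow,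
      (hsymm B hB).trace_pow_eq_sum_eigenvalues_pow] at heq
    rw [Multiset.map_map, Multiset.map_map]
    change ∑ i, |_| ^ (2 * k) = ∑ i, |_| ^ (2 * k)
    simpa [pow_mul] using heq
  have hall : ∀ᶠ k : ℕ in atTop, ∀ A ∈ Γ, ∀ B ∈ Γ,
      Matrix.trace (A ^ (2 * k)) = Matrix.trace (B ^ (2 * k)) → A = B := by
    rw [Γ.eventually_all]
    intro A hA
    rw [Γ.eventually_all]
    exact key A hA
  obtain ⟨k, hk⟩ := hall.exists
  exact ⟨2 * k, 2 * k, even_two_mul k, even_two_mul k,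
    fun A hA B hB hAB => hk A hA B hB (Prod.ext_iff.1 hAB).1⟩
end
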